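/- Let A be a 2×2 real matrix, v, l ∈ ℝ, and β ≥ 0. With P = v·I + l·J and G = (A·P + (A·P)ᵀ)/2, one has the pointwise estimate b_β(S(A), G) ≥ v·b_β(S(A), S(A)) − (1+2β)·(|l|/2)·‖A‖_F². -/

import Mathlib

open Matrix

/-- Frobenius inner product of 2×2 real matrices. -/
noncomputable def frobInner (T₁ T₂ : Matrix (Fin 2) (Fin 2) ℝ) : ℝ :=
  ∑ i, ∑ j, T₁ i j * T₂ i j

/-- The strain bilinear form `b_β(T₁,T₂) = ⟨T₁,T₂⟩_F + β (tr T₁)(tr T₂)`. -/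
noncomputable def bform (β : ℝ) (T₁ T₂ : Matrix (Fin 2) (Fin 2) ℝ) : ℝ :=
  frobInner T₁ T₂ + β * (T₁.trace * T₂.trace)

/-- Symmetric part `S(A) = (A + Aᵀ)/2`. -/
noncomputable def symPart (A : Matrix (Fin 2) (Fin 2) ℝ) : Matrix (Fin 2) (Fin 2) ℝ :=
  (1 / 2 : ℝ) • (A + Aᵀ)

/-- The rotation matrix `J = !![0, -1; 1, 0]`. -/
noncomputable def Jrot : Matrix (Fin 2) (Fin 2) ℝ := !![0, -1; 1, 0]

/-- Expansion of `b_β(S(A), S(A·(v·I + l·J)))`. -/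
lemma bform_symPart_mul_rotation (A : Matrix (Fin 2) (Fin 2) ℝ) (v l β : ℝ) :
    bform β (symPart A) (symPart (A * (v • (1 : Matrix (Fin 2) (Fin 2) ℝ) + l • Jrot))) =
      v * bform β (symPart A) (symPart A) +
        (1 + 2 * β) / 2 * (l * (A.trace * (A 0 1 - A 1 0))) := by
  simp [bform, frobInner, symPart, Jrot, Matrix.trace, Matrix.mul_apply, Fin.sum_univ_two]
  ring

/-- The trace times the skew part is bounded by the squared Frobenius norm. -/
lemma abs_trace_mul_sub_le_frobInner (A : Matrix (Fin 2) (Fin 2) ℝ) :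
    |A.trace * (A 0 1 - A 1 0)| ≤ frobInner A A := by
  simp only [frobInner, Matrix.trace, Matrix.diag_apply, Fin.sum_univ_two]
  rw [abs_le]
  constructor <;>
    nlinarith [sq_nonneg (A 0 0 + A 1 1 + (A 0 1 - A 1 0)),
      sq_nonneg (A 0 0 + A 1 1 - (A 0 1 - A 1 0)),
      sq_nonneg (A 0 0 - A 1 1), sq_nonneg (A 0 1 + A 1 0)]

/-- Pointwise multiplier estimate:
`b_β(S(A), G) ≥ v·b_β(S(A), S(A)) − (1+2β)·(|l|/2)·‖A‖_F²`,
where `G = S(A·(v·I + l·J))`. -/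
theorem stmt_5 (A : Matrix (Fin 2) (Fin 2) ℝ) (v l β : ℝ) (hβ : 0 ≤ β) :
    let P : Matrix (Fin 2) (Fin 2) ℝ := v • (1 : Matrix (Fin 2) (Fin 2) ℝ) + l • Jrot
    let G : Matrix (Fin 2) (Fin 2) ℝ := (1 / 2 : ℝ) • (A * P + (A * P)ᵀ)
    v * bform β (symPart A) (symPart A) - (1 + 2 * β) * (|l| / 2) * frobInner A A
      ≤ bform β (symPart A) G := by
  intro P G
  have hG : bform β (symPart A) G = _ := bform_symPart_mul_rotation A v l β
  have h : -(|l| * frobInner A A) ≤ l * (A.trace * (A 0 1 - A 1 0)) := by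
    refine (neg_le_neg ?_).trans (neg_abs_le _)
    rw [abs_mul]
    exact mul_le_mul_of_nonneg_left (abs_trace_mul_sub_le_frobInner A) (abs_nonneg l)
  have hmul := mul_le_mul_of_nonneg_left h (show 0 ≤ (1 + 2 * β) / 2 by positivity)
  rw [hG]
  linarith
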